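/- For u ≥ 0, r ≥ 0, R > 0 and y ∈ ℝ, set ψ_{u,R}(r,y) := 1_{{r ≤ u}}·∫_{−R}^{R} 1_{{|x−y| ≤ u−r}} dx. Then for all 0 ≤ s ≤ t, all r ≥ 0, all R > 0 and all y ∈ ℝ, |ψ_{t,R}(r,y) − ψ_{s,R}(r,y)| ≤ 4·(t−s)·1_{{|y| ≤ R+t}}. -/

import Mathlib

open MeasureTheory Real intervalIntegral

/-- `ψ_{u,R}(r,y) = 1_{r ≤ u} ∫_{-R}^R 1_{|x-y| ≤ u-r} dx`. -/
noncomputable def psi (u R r y : ℝ) : ℝ :=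
  (if r ≤ u then (1:ℝ) else 0) * ∫ x in (-R)..R, if |x - y| ≤ u - r then (1:ℝ) else 0

theorem integral_ite_abs_sub_le {R : ℝ} (hR : 0 ≤ R) (y d : ℝ) :
    ∫ x in (-R)..R, (if |x - y| ≤ d then (1 : ℝ) else 0) =
      max (min R (y + d) - max (-R) (y - d)) 0 := by
  have hind : (fun x : ℝ => if |x - y| ≤ d then (1 : ℝ) else 0) =
      (Set.Icc (y - d) (y + d)).indicator 1 := by
    ext x
    have hmem : |x - y| ≤ d ↔ x ∈ Set.Icc (y - d) (y + d) := by
      rw [abs_le, Set.mem_Icc]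
      constructor <;> rintro ⟨h₁, h₂⟩ <;> constructor <;> linarith
    simp [hmem, Set.indicator_apply]
  rw [hind, integral_of_le (by linarith), ← integral_Icc_eq_integral_Ioc,
    integral_indicator_one measurableSet_Icc, measureReal_restrict_apply measurableSet_Icc,
    Set.Icc_inter_Icc, Real.volume_real_Icc, max_comm (y - d), min_comm (y + d)]

theorem psi_eq {R : ℝ} (hR : 0 ≤ R) (u r y : ℝ) :
    psi u R r y = max (min R (y + (u - r)) - max (-R) (y - (u - r))) 0 := by
  rw [psi, integral_ite_abs_sub_le hR]
  split_ifs with h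
  · rw [one_mul]
  · rw [zero_mul, max_eq_right]
    linarith [min_le_right R (y + (u - r)), le_max_right (-R) (y - (u - r))]

theorem psi_eq_zero {u R r y : ℝ} (hR : 0 ≤ R) (hr : 0 ≤ r) (hy : R + u < |y|) :
    psi u R r y = 0 := by
  rw [psi_eq hR, max_eq_right]
  rcases lt_abs.1 hy with h | h
  · linarith [min_le_left R (y + (u - r)), le_max_right (-R) (y - (u - r))]
  · linarith [min_le_right R (y + (u - r)), le_max_left (-R) (y - (u - r))]

theorem abs_psi_sub_psi_le {s t R : ℝ} (hR : 0 ≤ R) (hst : s ≤ t) (r y : ℝ) :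
    |psi t R r y - psi s R r y| ≤ 2 * (t - s) := by
  rw [psi_eq hR, psi_eq hR]
  refine (abs_max_sub_max_le_abs _ _ _).trans ?_
  have hmin := abs_min_sub_min_le_max R (y + (t - r)) R (y + (s - r))
  have hmax := abs_max_sub_max_le_max (-R) (y - (t - r)) (-R) (y - (s - r))
  rw [sub_self, abs_zero, max_eq_right (a := 0) (abs_nonneg _)] at hmin hmax
  rw [show y + (t - r) - (y + (s - r)) = t - s by ring, abs_of_nonneg (sub_nonneg.2 hst)] at hmin
  rw [show y - (t - r) - (y - (s - r)) = -(t - s) by ring, abs_neg,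
    abs_of_nonneg (sub_nonneg.2 hst)] at hmax
  rw [abs_le] at hmin hmax ⊢
  constructor <;> linarith

/-- The key deterministic estimate in the proof of tightness (Proposition 4.1):
for `0 ≤ s ≤ t`, `r ≥ 0`, `R > 0` and `y ∈ ℝ`,
`|ψ_{t,R}(r,y) - ψ_{s,R}(r,y)| ≤ 4 (t-s) 1_{|y| ≤ R+t}`. -/
theorem stmt_12 (s t r R y : ℝ) (hs : 0 ≤ s) (hst : s ≤ t) (hr : 0 ≤ r) (hR : 0 < R) :
    |psi t R r y - psi s R r y| ≤
      4 * (t - s) * (if |y| ≤ R + t then (1:ℝ) else 0) := by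
  split_ifs with hy
  · linarith [abs_psi_sub_psi_le hR.le hst r y]
  · rw [not_le] at hy
    rw [psi_eq_zero hR.le hr hy, psi_eq_zero hR.le hr (by linarith)]
    simp
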